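/- Let P = ⟨H,M,T⟩ be an abduction problem with H = {h₁,…,hₙ}, and let C = {c₁,…,cₙ}, D = {d₁,…,dₙ}, E = {e₁,…,eₙ} be sets of fresh propositional variables in one-to-one correspondence with H. Define P' = ⟨H',M',T'⟩ by H' = C ∪ D, M' = M ∪ E, and T' = { cᵢ → hᵢ, cᵢ → eᵢ, dᵢ → eᵢ : 1 ≤ i ≤ n } ∪ T. If H₂ ∈ SOL(P'), then { hᵢ : cᵢ ∈ H₂ } ∈ SOL(P). -/

import Mathlib

/-- Propositional formulas over a set `V` of variables. -/
inductive PropForm (V : Type) : Type where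
  | fls  : PropForm V
  | var  : V → PropForm V
  | neg  : PropForm V → PropForm V
  | conj : PropForm V → PropForm V → PropForm V
  | disj : PropForm V → PropForm V → PropForm V
  | imp  : PropForm V → PropForm V → PropForm V
  deriving DecidableEq

namespace PropForm

/-- Truth of a formula under a valuation. -/
def eval {V : Type} (v : V → Prop) : PropForm V → Prop
  | fls => False
  | var x => v x
  | neg φ => ¬ eval v φ
  | conj φ ψ => eval v φ ∧ eval v ψ
  | disj φ ψ => eval v φ ∨ eval v ψ
  | imp φ ψ => eval v φ → eval v ψ

/-- The set of variables occurring in a formula. -/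
def vars {V : Type} : PropForm V → Set V
  | fls => ∅
  | var x => {x}
  | neg φ => vars φ
  | conj φ ψ => vars φ ∪ vars ψ
  | disj φ ψ => vars φ ∪ vars ψ
  | imp φ ψ => vars φ ∪ vars ψ

end PropForm

/-- An abduction problem `⟨H, M, T⟩`: hypotheses, manifestations, theory. -/
structure AbdProblem (V : Type) [DecidableEq V] : Type where
  H : Finset V
  M : Finset V
  T : Finset (PropForm V)

variable {V : Type} [DecidableEq V]

/-- `v` is a model of the hypotheses `A` together with the theory `T`. -/
def models (v : V → Prop) (A : Finset V) (T : Finset (PropForm V)) : Prop :=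
  (∀ x ∈ A, v x) ∧ (∀ φ ∈ T, φ.eval v)

/-- `A` is a solution of `P`: `A ⊆ H`, `A ∪ T` is satisfiable, `A ∪ T ⊨ m` for `m ∈ M`. -/
def isSol (P : AbdProblem V) (A : Finset V) : Prop :=
  A ⊆ P.H ∧ (∃ v, models v A P.T) ∧ ∀ v, models v A P.T → ∀ m ∈ P.M, v m

/-- The set of solutions of `P`. -/
def SOL (P : AbdProblem V) : Set (Finset V) := {A | isSol P A}

/-- The solutions of `P` minimal under set inclusion. -/
def SOLsub (P : AbdProblem V) : Set (Finset V) :=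
  {A | A ∈ SOL P ∧ ∀ B ∈ SOL P, B ⊆ A → B = A}

/-- The solutions of `P` of minimum cardinality. -/
def SOLcard (P : AbdProblem V) : Set (Finset V) :=
  {A | A ∈ SOL P ∧ ∀ B ∈ SOL P, A.card ≤ B.card}

/-- `x` is fresh for `P`: it occurs neither in `H`, nor in `M`, nor in any formula of `T`. -/
def freshFor (P : AbdProblem V) (x : V) : Prop :=
  x ∉ P.H ∧ x ∉ P.M ∧ ∀ φ ∈ P.T, x ∉ φ.vars

/-- The problem `P' = ⟨C ∪ D, M ∪ E, {cᵢ → hᵢ, cᵢ → eᵢ, dᵢ → eᵢ : i} ∪ T⟩`. -/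
def splitProb (P : AbdProblem V) {n : ℕ} (h c d e : Fin n → V) : AbdProblem V where
  H := Finset.univ.image c ∪ Finset.univ.image d
  M := P.M ∪ Finset.univ.image e
  T := Finset.univ.image (fun i => PropForm.imp (PropForm.var (c i)) (PropForm.var (h i)))
    ∪ Finset.univ.image (fun i => PropForm.imp (PropForm.var (c i)) (PropForm.var (e i)))
    ∪ Finset.univ.image (fun i => PropForm.imp (PropForm.var (d i)) (PropForm.var (e i)))
    ∪ P.T

theorem PropForm.eval_congr {W : Type} {v w : W → Prop} (φ : PropForm W)
    (hvw : ∀ x ∈ φ.vars, (v x ↔ w x)) : φ.eval v ↔ φ.eval w := by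
  induction φ with
  | fls => rfl
  | var x => exact hvw x rfl
  | neg φ ih => exact not_congr (ih hvw)
  | conj φ ψ ih₁ ih₂ =>
    exact and_congr (ih₁ fun x hx => hvw x (Or.inl hx)) (ih₂ fun x hx => hvw x (Or.inr hx))
  | disj φ ψ ih₁ ih₂ =>
    exact or_congr (ih₁ fun x hx => hvw x (Or.inl hx)) (ih₂ fun x hx => hvw x (Or.inr hx))
  | imp φ ψ ih₁ ih₂ =>
    exact imp_congr (ih₁ fun x hx => hvw x (Or.inl hx)) (ih₂ fun x hx => hvw x (Or.inr hx))

theorem models_splitProb_iff (P : AbdProblem V) {n : ℕ} (h c d e : Fin n → V)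
    (v : V → Prop) (A : Finset V) :
    models v A (splitProb P h c d e).T ↔
      models v A P.T ∧ (∀ i, v (c i) → v (h i)) ∧ (∀ i, v (c i) → v (e i)) ∧
        ∀ i, v (d i) → v (e i) := by
  simp only [models, splitProb, Finset.mem_union, Finset.mem_image, Finset.mem_univ, true_and,
    or_imp, forall_and, forall_exists_index, forall_apply_eq_imp_iff, PropForm.eval]
  tauto

/-- The valuation that agrees with `v` off the split variables, makes `c i` true exactly when
`c i ∈ A`, and makes every `d i` and `e i` true. -/
def splitValuation {n : ℕ} (c d e : Fin n → V) (A : Finset V) (v : V → Prop) (x : V) : Prop :=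
  x ∈ Set.range d ∨ x ∈ Set.range e ∨ (x ∈ Set.range c ∧ x ∈ A) ∨ (x ∉ Set.range c ∧ v x)

theorem splitValuation_iff_of_ne {W : Type} {n : ℕ} {c d e : Fin n → W} {x : W} (A : Finset W)
    (v : W → Prop) (hc : ∀ i, c i ≠ x) (hd : ∀ i, d i ≠ x) (he : ∀ i, e i ≠ x) :
    splitValuation c d e A v x ↔ v x := by
  simp [splitValuation, hc, hd, he]

theorem split_solution_projects (P : AbdProblem V) (n : ℕ) (h c d e : Fin n → V)
    (hH : P.H = Finset.univ.image h)
    (hinj : Function.Injective h) (cinj : Function.Injective c)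
    (dinj : Function.Injective d) (einj : Function.Injective e)
    (cfresh : ∀ i, freshFor P (c i)) (dfresh : ∀ i, freshFor P (d i))
    (efresh : ∀ i, freshFor P (e i))
    (cd : ∀ i j, c i ≠ d j) (ce : ∀ i j, c i ≠ e j) (de : ∀ i j, d i ≠ e j)
    (H₂ : Finset V) (hH₂ : H₂ ∈ SOL (splitProb P h c d e)) :
    (Finset.univ.filter (fun i => c i ∈ H₂)).image h ∈ SOL P := by
  obtain ⟨hsub, ⟨v₀, hv₀⟩, hent⟩ := hH₂
  have hmem : ∀ i, h i ∈ P.H := fun i => hH ▸ Finset.mem_image_of_mem h (Finset.mem_univ i)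
  refine ⟨?_, ⟨v₀, ?_⟩, fun v hv m hm => ?_⟩
  · rw [hH]
    exact Finset.image_subset_image (Finset.filter_subset _ _)
  · obtain ⟨⟨hA, hT⟩, hch, -, -⟩ := (models_splitProb_iff ..).1 hv₀
    refine ⟨fun x hx => ?_, hT⟩
    obtain ⟨i, hi, rfl⟩ := Finset.mem_image.1 hx
    exact hch i (hA _ (Finset.mem_filter.1 hi).2)
  · have hw_h (i) : splitValuation c d e H₂ v (h i) ↔ v (h i) :=
      splitValuation_iff_of_ne H₂ v (fun j hj => (cfresh j).1 (hj ▸ hmem i))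
        (fun j hj => (dfresh j).1 (hj ▸ hmem i)) (fun j hj => (efresh j).1 (hj ▸ hmem i))
    have hw_e (i) : splitValuation c d e H₂ v (e i) := Or.inr (Or.inl ⟨i, rfl⟩)
    have hw : models (splitValuation c d e H₂ v) H₂ (splitProb P h c d e).T := by
      refine (models_splitProb_iff ..).2
        ⟨⟨fun x hx => ?_, fun φ hφ => ?_⟩, fun i hi => ?_, fun i _ => hw_e i, fun i _ => hw_e i⟩
      · rcases Finset.mem_union.1 (hsub hx) with hx' | hx'
        · obtain ⟨i, -, rfl⟩ := Finset.mem_image.1 hx'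
          exact Or.inr (Or.inr (Or.inl ⟨⟨i, rfl⟩, hx⟩))
        · obtain ⟨i, -, rfl⟩ := Finset.mem_image.1 hx'
          exact Or.inl ⟨i, rfl⟩
      · refine (φ.eval_congr fun x hx => ?_).2 (hv.2 φ hφ)
        exact splitValuation_iff_of_ne H₂ v (fun j hj => (cfresh j).2.2 φ hφ (hj ▸ hx))
          (fun j hj => (dfresh j).2.2 φ hφ (hj ▸ hx)) (fun j hj => (efresh j).2.2 φ hφ (hj ▸ hx))
      · have hci : c i ∈ H₂ := by
          rcases hi with ⟨j, hj⟩ | ⟨j, hj⟩ | hi | hi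
          · exact absurd hj.symm (cd i j)
          · exact absurd hj.symm (ce i j)
          · exact hi.2
          · exact absurd ⟨i, rfl⟩ hi.1
        exact (hw_h i).2
          (hv.1 _ (Finset.mem_image_of_mem h (Finset.mem_filter.2 ⟨Finset.mem_univ i, hci⟩)))
    exact (splitValuation_iff_of_ne (c := c) (d := d) (e := e) H₂ v
      (fun j hj => (cfresh j).2.1 (hj ▸ hm)) (fun j hj => (dfresh j).2.1 (hj ▸ hm))
      (fun j hj => (efresh j).2.1 (hj ▸ hm))).1
      (hent _ hw m (Finset.mem_union_left _ hm))
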